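/- arXiv:2410.11515 — 3 statements merged into one kernel-verified Lean document; each statement's English description precedes it below -/
import Mathlib

section
/- Fix α > 1, β > 0, h > 0, c > 0, d ≥ 0, and N ≥ 1, and let the random fields be i.i.d. standard Gaussian. With v_n = β b_n 2^{−2n} for 1 ≤ n ≤ N, the generalized quenched pressure satisfies P_N(v_N, v_{N−1}, …, v_1) ≥ 2 P_{N−1}(2v_N + v_{N−1}, v_{N−2}, …, v_1) − log(1 + (c β^d b_N)^{1/2}) − E[ max_{1≤k≤r_N} log( Z_{k,1}(h₁)/Z_{k,2}(h₂) ) ] − 1/(c β^{d−1}). -/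
open MeasureTheory ProbabilityTheory Filter
open scoped Classical

noncomputable section

/-- The spin value (±1) of a Boolean configuration entry. -/
def spin (b : Bool) : ℝ := if b then 1 else -1

/-- The total spin `S_{n,1} = Σ_i σ_i` of a configuration of `2^n` spins. -/
def totalSpin (n : ℕ) (σ : Fin (2^n) → Bool) : ℝ := ∑ i, spin (σ i)

/-- The Dyson hierarchical Hamiltonian `H_N`, defined recursively:
`H_0 = 0`, `H_{N}(σ) = H_{N-1}(σ₁) + H_{N-1}(σ₂) - 2^{-αN} Σ_{i,j} σ_i σ_j`. -/
def dysonH (α : ℝ) : (N : ℕ) → (Fin (2^N) → Bool) → ℝ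
  | 0, _ => 0
  | (N+1), σ =>
      dysonH α N (fun i => σ ⟨i.1, by have := i.2; rw [pow_succ]; omega⟩)
    + dysonH α N (fun i => σ ⟨2^N + i.1, by have := i.2; rw [pow_succ]; omega⟩)
    - (2:ℝ) ^ (-(α * ((N:ℝ)+1))) *
        ∑ i : Fin (2^(N+1)), ∑ j : Fin (2^(N+1)), spin (σ i) * spin (σ j)

/-- The random-field Hamiltonian `H_N^{RF}(σ) = H_N(σ) - h Σ_i h_i σ_i`,
where `fh` is the field strength and `η` the realization of the random fields. -/
def dysonHRF (α fh : ℝ) (N : ℕ) (η : Fin (2^N) → ℝ) (σ : Fin (2^N) → Bool) : ℝ :=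
  dysonH α N σ - fh * ∑ i, η i * spin (σ i)

/-- The Gibbs average `⟨F⟩_N` with weight `exp(-β H_N^{RF}(σ))`. -/
def gibbs (α β fh : ℝ) (N : ℕ) (η : Fin (2^N) → ℝ) (F : (Fin (2^N) → Bool) → ℝ) : ℝ :=
  (∑ σ, F σ * Real.exp (-β * dysonHRF α fh N η σ)) /
    ∑ σ, Real.exp (-β * dysonHRF α fh N η σ)

/-- The law of `n` i.i.d. standard Gaussian random fields. -/
def gaussianFields (n : ℕ) : Measure (Fin n → ℝ) :=
  Measure.pi fun _ => gaussianReal 0 1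

/-- Expectation with respect to `n` i.i.d. symmetric Bernoulli (±1) random fields,
i.e. the uniform average over `{-1,+1}^n`. -/
def bernoulliExp (n : ℕ) (F : (Fin n → ℝ) → ℝ) : ℝ :=
  ((2:ℝ)^n)⁻¹ * ∑ ε : Fin n → Bool, F (fun i => spin (ε i))

/-- `f_N = 2^{-2N} E[⟨S_{N,1}²⟩_N]` with i.i.d. standard Gaussian random fields. -/
def fG (α β fh : ℝ) (N : ℕ) : ℝ :=
  ((2:ℝ)^(2*N))⁻¹ *
    ∫ η, gibbs α β fh N η (fun σ => (totalSpin N σ)^2) ∂ gaussianFields (2^N)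

/-- `f_N = 2^{-2N} E[⟨S_{N,1}²⟩_N]` with i.i.d. symmetric Bernoulli random fields. -/
def fB (α β fh : ℝ) (N : ℕ) : ℝ :=
  ((2:ℝ)^(2*N))⁻¹ *
    bernoulliExp (2^N) (fun η => gibbs α β fh N η (fun σ => (totalSpin N σ)^2))

/-- `b_n = 2^{(2-α)n}`. -/
def bcoef (α : ℝ) (n : ℕ) : ℝ := (2:ℝ) ^ (((2:ℝ) - α) * n)

/-- The first half `(h_1, …, h_{2^{N-1}})` of the random fields. -/
def half1 (N : ℕ) (η : Fin (2^N) → ℝ) : Fin (2^(N-1)) → ℝ :=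
  fun i => η ⟨i.1, lt_of_lt_of_le i.2 (Nat.pow_le_pow_right (by norm_num) (Nat.sub_le N 1))⟩

/-- The second half `(h_{2^{N-1}+1}, …, h_{2^N})` of the random fields. -/
def half2 (N : ℕ) (η : Fin (2^N) → ℝ) : Fin (2^(N-1)) → ℝ :=
  fun i => if hlt : 2^(N-1) + i.1 < 2^N then η ⟨2^(N-1) + i.1, hlt⟩ else 0

/-- Membership in the `k`-th of the `r` equal subintervals `I_k` of `[-2^{N-1}, 2^{N-1}]`. -/
def inBlock (N r k : ℕ) (x : ℝ) : Prop :=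
  -(2:ℝ)^(N-1) + ((k:ℝ)-1) * ((2:ℝ)^N / r) ≤ x ∧
    x ≤ -(2:ℝ)^(N-1) + (k:ℝ) * ((2:ℝ)^N / r)

/-- The restricted partition function
`Z_k(η) = Σ_{σ : S_{N-1} ∈ I_k} exp(-β H_{N-1}^{RF}(σ) + 2β b_N 2^{-2N} S_{N-1}²)`,
on `2^{N-1}` spins with fields `η`. Both `Z_{k,1}` and `Z_{k,2}` are this function,
applied to the first resp. second half of the random fields. -/
def Zres (α β fh : ℝ) (N r k : ℕ) (η : Fin (2^(N-1)) → ℝ) : ℝ :=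
  ∑ σ : Fin (2^(N-1)) → Bool,
    if inBlock N r k (totalSpin (N-1) σ) then
      Real.exp (-β * dysonHRF α fh (N-1) η σ
        + 2 * β * bcoef α N * ((2:ℝ)^(2*N))⁻¹ * (totalSpin (N-1) σ)^2)
    else 0

/-- `g_k = log (Z_{k,1}(h₁) / Z_{k,2}(h₂))` as a function of all the random fields. -/
def gk (α β fh : ℝ) (N r k : ℕ) (η : Fin (2^N) → ℝ) : ℝ :=
  Real.log (Zres α β fh N r k (half1 N η) / Zres α β fh N r k (half2 N η))

/-- `max_{1 ≤ k ≤ r} g_k`. -/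
def maxgk (α β fh : ℝ) (N r : ℕ) (hr : 1 ≤ r) (η : Fin (2^N) → ℝ) : ℝ :=
  (Finset.Icc 1 r).sup' (Finset.nonempty_Icc.mpr hr) (fun k => gk α β fh N r k η)

/-- The sum of the spins in the `B`-th consecutive block of size `2^n` (out of `2^{N-n}`). -/
def blockSum (N n : ℕ) (σ : Fin (2^N) → Bool) (B : Fin (2^(N-n))) : ℝ :=
  ∑ j : Fin (2^n), if hlt : B.1 * 2^n + j.1 < 2^N then spin (σ ⟨B.1 * 2^n + j.1, hlt⟩) else 0

/-- The generalized pressure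
`P_N(v_N, …, v_1) = log Σ_σ exp(Σ_{n=1}^N v_n Σ_B (Σ_{i∈B} σ_i)² + β h Σ_i h_i σ_i)`
for a given realization `η` of the random fields; the quenched pressure is its
expectation over the fields. -/
def pressure (β fh : ℝ) (N : ℕ) (v : ℕ → ℝ) (η : Fin (2^N) → ℝ) : ℝ :=
  Real.log (∑ σ : Fin (2^N) → Bool,
    Real.exp ((∑ n ∈ Finset.Icc 1 N, v n * ∑ B : Fin (2^(N-n)), (blockSum N n σ B)^2)
      + β * fh * ∑ i, η i * spin (σ i)))

/-- The couplings `v_n = β b_n 2^{-2n}` corresponding to `-β H_N`. -/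
def vcoup (α β : ℝ) (n : ℕ) : ℝ := β * bcoef α n * ((2:ℝ)^(2*n))⁻¹

/-- `f_N = 2^{-2N} ⟨S_{N,1}²⟩_N` without random field. -/
def fNoField (α β : ℝ) (N : ℕ) : ℝ :=
  ((2:ℝ)^(2*N))⁻¹ * gibbs α β 0 N (fun _ => 0) (fun σ => (totalSpin N σ)^2)

/-- The `p`-th term of the series bounding `1 - f_N` from above. -/
def seriesTerm (α β fh c : ℝ) (p : ℕ) : ℝ :=
  (1/(β * bcoef α p)) * (β/c + Real.log (2 * Real.sqrt (c * bcoef α p))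
    + β * fh * (2:ℝ)^((p:ℝ)/2) *
      Real.log (2 * Real.sqrt (c * bcoef α p) * (1 + Real.sqrt (2*Real.pi*Real.exp 1))))

def loI (M : ℕ) (i : Fin (2^M)) : Fin (2^(M+1)) :=
  ⟨i.1, by have := i.2; rw [pow_succ]; omega⟩

def hiI (M : ℕ) (i : Fin (2^M)) : Fin (2^(M+1)) :=
  ⟨2^M + i.1, by have := i.2; rw [pow_succ]; omega⟩

def splitE (M : ℕ) : Fin (2^M) ⊕ Fin (2^M) ≃ Fin (2^(M+1)) :=
  finSumFinEquiv.trans (finCongr (by rw [pow_succ]; omega))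

lemma splitE_inl (M : ℕ) (i : Fin (2^M)) : splitE M (Sum.inl i) = loI M i := by
  ext; simp [splitE, loI]

lemma splitE_inr (M : ℕ) (i : Fin (2^M)) : splitE M (Sum.inr i) = hiI M i := by
  ext; simp [splitE, hiI, add_comm]

lemma sum_split (M : ℕ) (f : Fin (2^(M+1)) → ℝ) :
    ∑ i, f i = ∑ i, f (loI M i) + ∑ i, f (hiI M i) := by
  rw [← (splitE M).sum_comp, Fintype.sum_sum_type]
  simp only [splitE_inl, splitE_inr]

def cfgE (M : ℕ) : (Fin (2^(M+1)) → Bool) ≃ (Fin (2^M) → Bool) × (Fin (2^M) → Bool) :=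
  ((splitE M).symm.arrowCongr (Equiv.refl Bool)).trans (Equiv.sumArrowEquivProdArrow _ _ _)

lemma cfgE_apply (M : ℕ) (σ : Fin (2^(M+1)) → Bool) :
    cfgE M σ = (fun i => σ (loI M i), fun i => σ (hiI M i)) := by
  ext i
  · simp [cfgE, ← splitE_inl, Equiv.arrowCongr]
  · simp [cfgE, ← splitE_inr, Equiv.arrowCongr]

lemma sum_cfg (M : ℕ) (F : (Fin (2^M) → Bool) → (Fin (2^M) → Bool) → ℝ) :
    ∑ σ : Fin (2^(M+1)) → Bool, F (fun i => σ (loI M i)) (fun i => σ (hiI M i))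
      = ∑ a, ∑ b, F a b := by
  rw [← Fintype.sum_prod_type', ← (cfgE M).sum_comp]
  simp only [cfgE_apply]

def bsN (N n : ℕ) (σ : Fin (2^N) → Bool) (b : ℕ) : ℝ :=
  ∑ j : Fin (2^n), if hlt : b * 2^n + j.1 < 2^N then spin (σ ⟨b * 2^n + j.1, hlt⟩) else 0

def enr (N : ℕ) (v : ℕ → ℝ) (σ : Fin (2^N) → Bool) : ℝ :=
  ∑ n ∈ Finset.Icc 1 N, v n * ∑ B : Fin (2^(N-n)), (blockSum N n σ B)^2

lemma sum_block (N n : ℕ) (σ : Fin (2^N) → Bool) :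
    ∑ B : Fin (2^(N-n)), (blockSum N n σ B)^2
      = ∑ b ∈ Finset.range (2^(N-n)), (bsN N n σ b)^2 :=
  Fin.sum_univ_eq_sum_range (fun b => (bsN N n σ b)^2) _

lemma sum_block_top (N : ℕ) (σ : Fin (2^N) → Bool) :
    ∑ B : Fin (2^(N-N)), (blockSum N N σ B)^2 = (totalSpin N σ)^2 := by
  rw [sum_block]
  simp [bsN, totalSpin]

lemma block_idx (M n b j : ℕ) (hn : n ≤ M) (hb : b < 2^(M-n)) (hj : j < 2^n) :
    b * 2^n + j < 2^M := by
  have h : 2^(M-n) * 2^n = 2^M := by rw [← pow_add]; congr 1; omega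
  have : (b+1) * 2^n ≤ 2^(M-n) * 2^n := Nat.mul_le_mul_right _ hb
  rw [add_mul] at this
  omega

lemma sum_block_step (M n : ℕ) (hn : n ≤ M) (σ : Fin (2^(M+1)) → Bool) :
    ∑ B : Fin (2^(M+1-n)), (blockSum (M+1) n σ B)^2
      = ∑ B : Fin (2^(M-n)), (blockSum M n (fun i => σ (loI M i)) B)^2
        + ∑ B : Fin (2^(M-n)), (blockSum M n (fun i => σ (hiI M i)) B)^2 := by
  rw [sum_block, sum_block, sum_block]
  have h1 : 2^(M+1-n) = 2^(M-n) + 2^(M-n) := by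
    rw [Nat.succ_sub hn, pow_succ]; omega
  have h : 2^(M-n) * 2^n = 2^M := by rw [← pow_add]; congr 1; omega
  have hM : 2^(M+1) = 2^M + 2^M := by rw [pow_succ]; omega
  rw [h1, Finset.sum_range_add]
  congr 1
  · refine Finset.sum_congr rfl fun b hb => ?_
    congr 1
    refine Finset.sum_congr rfl fun j _ => ?_
    have := block_idx M n b j hn (Finset.mem_range.1 hb) j.2
    rw [dif_pos this, dif_pos (by omega)]
    rfl
  · refine Finset.sum_congr rfl fun b hb => ?_
    congr 1
    refine Finset.sum_congr rfl fun j _ => ?_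
    have := block_idx M n b j hn (Finset.mem_range.1 hb) j.2
    have e : (2^(M-n) + b) * 2^n + j.1 = 2^M + (b * 2^n + j.1) := by
      rw [add_mul, h]; omega
    rw [dif_pos this, dif_pos (by omega)]
    congr 2
    ext
    simp only [hiI]
    exact e

lemma enr_succ (M : ℕ) (v : ℕ → ℝ) (σ : Fin (2^(M+1)) → Bool) :
    enr (M+1) v σ = enr M v (fun i => σ (loI M i)) + enr M v (fun i => σ (hiI M i))
      + v (M+1) * (totalSpin (M+1) σ)^2 := by
  unfold enr
  rw [Finset.sum_Icc_succ_top (by omega), sum_block_top, ← Finset.sum_add_distrib]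
  congr 1
  refine Finset.sum_congr rfl fun n hn => ?_
  rw [sum_block_step M n (Finset.mem_Icc.1 hn).2, mul_add]

lemma totalSpin_succ (M : ℕ) (σ : Fin (2^(M+1)) → Bool) :
    totalSpin (M+1) σ = totalSpin M (fun i => σ (loI M i)) + totalSpin M (fun i => σ (hiI M i)) :=
  sum_split M _

lemma vcoup_eq (α β : ℝ) (n : ℕ) : vcoup α β n = β * (2:ℝ) ^ (-(α * (n:ℝ))) := by
  unfold vcoup bcoef
  rw [mul_assoc]
  congr 1
  rw [← Real.rpow_natCast, ← Real.rpow_neg (by norm_num), ← Real.rpow_add (by norm_num)]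
  congr 1
  push_cast
  ring

lemma dysonH_eq (α β : ℝ) (N : ℕ) (σ : Fin (2^N) → Bool) :
    -β * dysonH α N σ = enr N (vcoup α β) σ := by
  induction N with
  | zero => simp [dysonH, enr]
  | succ M ih =>
    rw [enr_succ, ← ih, ← ih, vcoup_eq]
    have : ∑ i : Fin (2^(M+1)), ∑ j : Fin (2^(M+1)), spin (σ i) * spin (σ j)
        = (totalSpin (M+1) σ)^2 := by
      rw [sq, totalSpin, Finset.sum_mul_sum]
    simp only [dysonH, this, loI, hiI]
    push_cast
    ring

lemma enr_update (M : ℕ) (v : ℕ → ℝ) (t : ℝ) (ht : 0 ≤ t) (σ : Fin (2^M) → Bool) :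
    enr M (Function.update v M (t + v M)) σ ≤ enr M v σ + t * (totalSpin M σ)^2 := by
  cases M with
  | zero => simp [enr]; positivity
  | succ M =>
    rw [enr_succ, enr_succ]
    have : ∀ τ : Fin (2^M) → Bool,
        enr M (Function.update v (M+1) (t + v (M+1))) τ = enr M v τ := by
      intro τ
      refine Finset.sum_congr rfl fun n hn => ?_
      rw [Function.update_of_ne]
      have := (Finset.mem_Icc.1 hn).2
      omega
    rw [this, this, Function.update_self]
    linarith

lemma spin_abs (b : Bool) : |spin b| = 1 := by cases b <;> simp [spin]

lemma totalSpin_abs (M : ℕ) (σ : Fin (2^M) → Bool) : |totalSpin M σ| ≤ 2^M := by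
  refine (Finset.abs_sum_le_sum_abs _ _).trans ?_
  simp [spin_abs]

lemma exists_block (M r : ℕ) (hr : 1 ≤ r) (x : ℝ) (hx : |x| ≤ 2^M) :
    ∃ k ∈ Finset.Icc 1 r, inBlock (M+1) r k x := by
  have hr0 : (0:ℝ) < r := by exact_mod_cast hr
  obtain ⟨h1, h2⟩ := abs_le.1 hx
  have hp : (0:ℝ) < 2^(M+1) := by positivity
  have hp2 : (2:ℝ)^(M+1) = 2 * 2^M := by ring
  set w : ℝ := (2:ℝ)^(M+1) / r with hw
  have hw0 : 0 < w := by positivity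
  have hwr : r * w = 2^(M+1) := by rw [hw]; field_simp
  set y : ℝ := (x + 2^M) / w with hy
  have hxy : x = -2^M + y * w := by rw [hy]; field_simp; ring
  have hy0 : 0 ≤ y := div_nonneg (by linarith) hw0.le
  have hyr : y ≤ r := by
    rw [hy, div_le_iff₀ hw0, hwr]; linarith
  refine ⟨max 1 ⌈y⌉₊, Finset.mem_Icc.2 ⟨le_max_left _ _, max_le hr (Nat.ceil_le.2 hyr)⟩, ?_⟩
  unfold inBlock
  simp only [Nat.add_sub_cancel]
  rw [← hw]
  have ha : ((max 1 ⌈y⌉₊ : ℕ) : ℝ) - 1 ≤ y := by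
    rcases le_total 1 ⌈y⌉₊ with h | h
    · rw [max_eq_right h]; have := Nat.ceil_lt_add_one hy0; linarith
    · rw [max_eq_left h]; simpa using hy0
  have hb : y ≤ ((max 1 ⌈y⌉₊ : ℕ) : ℝ) :=
    (Nat.le_ceil y).trans (by exact_mod_cast le_max_right _ _)
  constructor
  · have := mul_le_mul_of_nonneg_right ha hw0.le; linarith
  · have := mul_le_mul_of_nonneg_right hb hw0.le; linarith

lemma half1_eq (M : ℕ) (η : Fin (2^(M+1)) → ℝ) : half1 (M+1) η = fun i => η (loI M i) := rfl

lemma half2_eq (M : ℕ) (η : Fin (2^(M+1)) → ℝ) : half2 (M+1) η = fun i => η (hiI M i) := by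
  funext i
  exact dif_pos (hiI M i).2

lemma mp_comp {m n : ℕ} (e : Fin m → Fin n) (he : Function.Injective e) :
    MeasurePreserving (fun (η : Fin n → ℝ) i => η (e i)) (gaussianFields n) (gaussianFields m) := by
  refine ⟨by fun_prop, ?_⟩
  unfold gaussianFields
  have h := iIndepFun_pi (μ := fun _ : Fin n => gaussianReal 0 1) (X := fun _ (x : ℝ) => x)
    (fun _ => aemeasurable_id)
  have h2 := h.precomp he
  rw [iIndepFun_iff_map_fun_eq_pi_map (fun i => (measurable_pi_apply (e i)).aemeasurable)] at h2
  rw [h2]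
  congr 1
  funext i
  exact (measurePreserving_eval (fun _ : Fin n => gaussianReal 0 1) (e i)).map_eq

lemma loI_inj (M : ℕ) : Function.Injective (loI M) := by
  intro a b h
  simp only [loI, Fin.mk.injEq] at h
  exact Fin.ext h

lemma hiI_inj (M : ℕ) : Function.Injective (hiI M) := by
  intro a b h
  simp only [hiI, Fin.mk.injEq] at h
  exact Fin.ext (by omega)

lemma integ_log (n : ℕ) (s : Finset (Fin n → Bool)) (a : (Fin n → Bool) → ℝ) (κ : ℝ) :
    Integrable (fun η : Fin n → ℝ =>
      Real.log (∑ σ ∈ s, Real.exp (a σ + κ * ∑ i, η i * spin (σ i)))) (gaussianFields n) := by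
  rcases s.eq_empty_or_nonempty with rfl | ⟨σ0, h0⟩
  · simp
  have : IsProbabilityMeasure (gaussianFields n) := by unfold gaussianFields; infer_instance
  have hi : ∀ i, Integrable (fun η : Fin n → ℝ => |η i|) (gaussianFields n) := by
    intro i
    have h1 : Integrable (fun x : ℝ => x) (gaussianReal 0 1) :=
      memLp_one_iff_integrable.1 (memLp_id_gaussianReal' (μ := 0) (v := 1) 1 (by simp))
    exact (integrable_comp_eval (μ := fun _ : Fin n => gaussianReal 0 1) (i := i) h1).abs
  have hdom : Integrable (fun η : Fin n → ℝ =>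
      (∑ σ ∈ s, |a σ| + |κ| * ∑ i, |η i|) + Real.log s.card) (gaussianFields n) :=
    ((integrable_const _).add ((integrable_finsetSum _ fun i _ => hi i).const_mul _)).add
      (integrable_const _)
  refine hdom.mono' (Measurable.aestronglyMeasurable (by fun_prop)) (ae_of_all _ fun η => ?_)
  have hb : ∀ σ ∈ s, |a σ + κ * ∑ i, η i * spin (σ i)| ≤ ∑ σ ∈ s, |a σ| + |κ| * ∑ i, |η i| := by
    intro σ hσ
    refine (abs_add_le _ _).trans (add_le_add ?_ ?_)
    · exact Finset.single_le_sum (f := fun σ => |a σ|) (fun _ _ => abs_nonneg _) hσ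
    · rw [abs_mul]
      refine mul_le_mul_of_nonneg_left ((Finset.abs_sum_le_sum_abs _ _).trans (le_of_eq ?_))
        (abs_nonneg _)
      simp [abs_mul, spin_abs]
  set D := ∑ σ ∈ s, |a σ| + |κ| * ∑ i, |η i|
  have hcard : (1:ℝ) ≤ s.card := by exact_mod_cast Finset.card_pos.2 ⟨σ0, h0⟩
  have hpos : 0 < ∑ σ ∈ s, Real.exp (a σ + κ * ∑ i, η i * spin (σ i)) :=
    Finset.sum_pos (fun _ _ => Real.exp_pos _) ⟨σ0, h0⟩
  have hlog : 0 ≤ Real.log s.card := Real.log_nonneg hcard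
  rw [Real.norm_eq_abs, abs_le]
  constructor
  · rw [Real.le_log_iff_exp_le hpos]
    refine le_trans ?_ (Finset.single_le_sum
      (f := fun σ => Real.exp (a σ + κ * ∑ i, η i * spin (σ i)))
      (fun _ _ => (Real.exp_pos _).le) h0)
    refine Real.exp_le_exp.2 ?_
    have := (abs_le.1 (hb σ0 h0)).1
    linarith
  · rw [Real.log_le_iff_le_exp hpos, Real.exp_add, Real.exp_log (by linarith), mul_comm,
      ← nsmul_eq_mul]
    exact Finset.sum_le_card_nsmul _ _ _ fun σ hσ => Real.exp_le_exp.2 (abs_le.1 (hb σ hσ)).2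

lemma pressure_integ (β fh : ℝ) (N : ℕ) (v : ℕ → ℝ) :
    Integrable (pressure β fh N v) (gaussianFields (2^N)) :=
  integ_log (2^N) Finset.univ (fun σ => enr N v σ) (β * fh)

def wt (α β fh : ℝ) (M : ℕ) (η : Fin (2^M) → ℝ) (σ : Fin (2^M) → Bool) : ℝ :=
  Real.exp (enr M (vcoup α β) σ + 2 * vcoup α β (M+1) * (totalSpin M σ)^2
    + β * fh * ∑ i, η i * spin (σ i))

lemma Zres_eq (α β fh : ℝ) (M r k : ℕ) (η : Fin (2^M) → ℝ) :
    Zres α β fh (M+1) r k η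
      = ∑ σ : Fin (2^M) → Bool, if inBlock (M+1) r k (totalSpin M σ) then wt α β fh M η σ else 0 := by
  unfold Zres wt
  refine Finset.sum_congr rfl fun (σ : Fin (2^M) → Bool) _ => ?_
  congr 2
  change -β * dysonHRF α fh M η σ
    + 2 * β * bcoef α (M+1) * ((2:ℝ)^(2*(M+1)))⁻¹ * (totalSpin M σ)^2 = _
  rw [← dysonH_eq]
  unfold dysonHRF vcoup
  ring

lemma Zres_eq' (α β fh : ℝ) (M r k : ℕ) (η : Fin (2^M) → ℝ) :
    Zres α β fh (M+1) r k η
      = ∑ σ with inBlock (M+1) r k (totalSpin M σ), wt α β fh M η σ := by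
  rw [Zres_eq, Finset.sum_filter]

lemma logZ_integ (α β fh : ℝ) (M r k : ℕ) :
    Integrable (fun η => Real.log (Zres α β fh (M+1) r k η)) (gaussianFields (2^M)) := by
  simp only [Zres_eq']
  exact integ_log (2^M) _ _ (β * fh)

lemma Zres_pos_or (α β fh : ℝ) (M r k : ℕ) :
    (∀ η, Zres α β fh (M+1) r k η = 0) ∨ (∀ η, 0 < Zres α β fh (M+1) r k η) := by
  simp only [Zres_eq']
  rcases (Finset.univ.filter fun σ : Fin (2^M) → Bool =>
    inBlock (M+1) r k (totalSpin M σ)).eq_empty_or_nonempty with h | h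
  · left; intro η; rw [h]; simp
  · right; intro η; exact Finset.sum_pos (fun _ _ => Real.exp_pos _) h

lemma gk_integ (α β fh : ℝ) (M r k : ℕ) :
    Integrable (gk α β fh (M+1) r k) (gaussianFields (2^(M+1))) := by
  have h : gk α β fh (M+1) r k = fun η =>
      Real.log (Zres α β fh (M+1) r k (fun i => η (loI M i)))
        - Real.log (Zres α β fh (M+1) r k (fun i => η (hiI M i))) := by
    funext η
    unfold gk
    rw [half1_eq, half2_eq]
    rcases Zres_pos_or α β fh M r k with h | h
    · erw [h, h]; simp
    · exact Real.log_div (h _).ne' (h _).ne'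
  rw [h]
  exact ((mp_comp _ (loI_inj M)).integrable_comp_of_integrable (logZ_integ α β fh M r k)).sub
    ((mp_comp _ (hiI_inj M)).integrable_comp_of_integrable (logZ_integ α β fh M r k))

lemma maxgk_integ (α β fh : ℝ) (M r : ℕ) (hr : 1 ≤ r) :
    Integrable (maxgk α β fh (M+1) r hr) (gaussianFields (2^(M+1))) := by
  have : maxgk α β fh (M+1) r hr
      = (Finset.Icc 1 r).sup' (Finset.nonempty_Icc.mpr hr) (fun k => gk α β fh (M+1) r k) := by
    funext η
    rw [Finset.sup'_apply]
    rfl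
  rw [this]
  exact Finset.sup'_induction (p := fun f => Integrable f (gaussianFields (2^(M+1)))) _ _
    (fun _ h1 _ h2 => h1.sup h2) (fun k _ => gk_integ α β fh M r k)

lemma Zres_le (α β fh : ℝ) (M r : ℕ) (hr : 1 ≤ r) (η : Fin (2^(M+1)) → ℝ) (k : ℕ)
    (hk : k ∈ Finset.Icc 1 r) :
    Real.exp (-maxgk α β fh (M+1) r hr η) * Zres α β fh (M+1) r k (fun i => η (loI M i))
      ≤ Zres α β fh (M+1) r k (fun i => η (hiI M i)) := by
  rcases Zres_pos_or α β fh M r k with h | h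
  · rw [h, h]; simp
  have h1 := h (fun i => η (loI M i))
  have h2 := h (fun i => η (hiI M i))
  have hg : gk α β fh (M+1) r k η ≤ maxgk α β fh (M+1) r hr η :=
    Finset.le_sup' (fun k => gk α β fh (M+1) r k η) hk
  unfold gk at hg
  rw [half1_eq, half2_eq] at hg
  have h3 := (Real.log_le_iff_le_exp (div_pos h1 h2)).1 hg
  have h4 := (div_le_iff₀ h2).1 h3
  rw [Real.exp_neg, inv_mul_le_iff₀ (Real.exp_pos _)]
  exact h4

lemma pointwise (α β fh C : ℝ) (hβ : 0 < β) (M r : ℕ) (hr : 1 ≤ r)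
    (hC : vcoup α β (M+1) * (2^(M+1) / r)^2 ≤ C) (η : Fin (2^(M+1)) → ℝ) :
    2 * pressure β fh M (Function.update (vcoup α β) M (2 * vcoup α β (M+1) + vcoup α β M))
        (fun i => η (loI M i)) - Real.log r - maxgk α β fh (M+1) r hr η - C
      ≤ pressure β fh (M+1) (vcoup α β) η := by
  set v := vcoup α β with hv
  set η1 : Fin (2^M) → ℝ := fun i => η (loI M i) with hη1
  set η2 : Fin (2^M) → ℝ := fun i => η (hiI M i) with hη2
  set g := maxgk α β fh (M+1) r hr η with hg
  have hr0 : (0:ℝ) < r := by exact_mod_cast hr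
  have hv0 : 0 ≤ v (M+1) := by
    rw [hv, vcoup_eq]; positivity
  have hwpos : ∀ η' σ, 0 < wt α β fh M η' σ := fun _ _ => Real.exp_pos _
  set W := ∑ σ, wt α β fh M η1 σ with hW
  have hW0 : 0 < W := Finset.sum_pos (fun _ _ => hwpos _ _) Finset.univ_nonempty
  have hP : pressure β fh M (Function.update v M (2 * v (M+1) + v M)) η1 ≤ Real.log W := by
    refine Real.log_le_log (Finset.sum_pos (fun _ _ => Real.exp_pos _) Finset.univ_nonempty) ?_
    refine Finset.sum_le_sum fun σ _ => Real.exp_le_exp.2 ?_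
    exact add_le_add (enr_update M v _ (by positivity) σ) le_rfl
  choose κ hκ1 hκ2 using fun σ : Fin (2^M) → Bool =>
    exists_block M r hr (totalSpin M σ) (totalSpin_abs M σ)
  set A : ℕ → ℝ := fun k => ∑ σ with κ σ = k, wt α β fh M η1 σ with hA
  have hA0 : ∀ k, 0 ≤ A k := fun k => Finset.sum_nonneg fun _ _ => (hwpos _ _).le
  have hAW : ∑ k ∈ Finset.Icc 1 r, A k = W :=
    Finset.sum_fiberwise_of_maps_to (fun σ _ => hκ1 σ) _
  have hAZ : ∀ k, A k ≤ Zres α β fh (M+1) r k η1 := by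
    intro k
    rw [Zres_eq']
    refine Finset.sum_le_sum_of_subset_of_nonneg ?_ fun _ _ _ => (hwpos _ _).le
    intro σ hσ
    simp only [Finset.mem_filter, Finset.mem_univ, true_and] at hσ ⊢
    rw [← hσ]; exact hκ2 σ
  have hCS : W^2 ≤ r * ∑ k ∈ Finset.Icc 1 r, A k^2 := by
    have := sq_sum_le_card_mul_sum_sq (s := Finset.Icc 1 r) (f := A)
    rw [hAW] at this
    simpa using this
  set Z := ∑ σ : Fin (2^(M+1)) → Bool,
    Real.exp (enr (M+1) v σ + β * fh * ∑ i, η i * spin (σ i)) with hZ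
  have hZP : pressure β fh (M+1) v η = Real.log Z := rfl
  have hZ1 : Z = ∑ a, ∑ b, wt α β fh M η1 a * wt α β fh M η2 b *
      Real.exp (-(v (M+1) * (totalSpin M a - totalSpin M b)^2)) := by
    rw [← sum_cfg, hZ]
    refine Finset.sum_congr rfl fun σ _ => ?_
    unfold wt
    rw [← Real.exp_add, ← Real.exp_add, enr_succ, totalSpin_succ, sum_split M]
    congr 1
    simp only [← hv, hη1, hη2]
    ring
  have hZ2 : Real.exp (-C) * ∑ a, wt α β fh M η1 a * Zres α β fh (M+1) r (κ a) η2 ≤ Z := by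
    rw [hZ1, Finset.mul_sum]
    refine Finset.sum_le_sum fun a _ => ?_
    rw [Zres_eq, Finset.mul_sum, Finset.mul_sum]
    refine Finset.sum_le_sum fun b _ => ?_
    have hp := mul_pos (hwpos η1 a) (hwpos η2 b)
    split_ifs with hb
    · rw [mul_comm]
      refine mul_le_mul_of_nonneg_left (Real.exp_le_exp.2 (neg_le_neg ?_)) hp.le
      refine le_trans (mul_le_mul_of_nonneg_left ?_ hv0) hC
      have ha := hκ2 a
      unfold inBlock at ha hb
      refine sq_le_sq' ?_ ?_
      · have e : ((κ a : ℝ) - 1) * (2^(M+1) / r) = κ a * (2^(M+1) / r) - 2^(M+1) / r := by ring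
        rw [e] at ha hb
        linarith [ha.1, hb.2]
      · have e : ((κ a : ℝ) - 1) * (2^(M+1) / r) = κ a * (2^(M+1) / r) - 2^(M+1) / r := by ring
        rw [e] at ha hb
        linarith [ha.2, hb.1]
    · simp only [mul_zero]
      positivity
  have hZ3 : ∑ a, wt α β fh M η1 a * Zres α β fh (M+1) r (κ a) η2
      = ∑ k ∈ Finset.Icc 1 r, A k * Zres α β fh (M+1) r k η2 := by
    rw [← Finset.sum_fiberwise_of_maps_to (fun σ _ => hκ1 σ)]
    refine Finset.sum_congr rfl fun k _ => ?_
    rw [hA, Finset.sum_mul]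
    refine Finset.sum_congr rfl fun σ hσ => ?_
    rw [(Finset.mem_filter.1 hσ).2]
  have hZ4 : Real.exp (-g) * ∑ k ∈ Finset.Icc 1 r, A k^2
      ≤ ∑ k ∈ Finset.Icc 1 r, A k * Zres α β fh (M+1) r k η2 := by
    rw [Finset.mul_sum]
    refine Finset.sum_le_sum fun k hk => ?_
    have h1 := Zres_le α β fh M r hr η k hk
    have h2 := mul_le_mul_of_nonneg_left (hAZ k) (Real.exp_pos (-g)).le
    calc Real.exp (-g) * A k^2 = A k * (Real.exp (-g) * A k) := by ring
      _ ≤ _ := mul_le_mul_of_nonneg_left (h2.trans h1) (hA0 k)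
  have hfin : Real.exp (-C) * (Real.exp (-g) * (W^2 / r)) ≤ Z := by
    refine le_trans ?_ hZ2
    rw [hZ3]
    refine mul_le_mul_of_nonneg_left (le_trans ?_ hZ4) (Real.exp_pos _).le
    refine mul_le_mul_of_nonneg_left ?_ (Real.exp_pos _).le
    rw [div_le_iff₀' hr0]; exact hCS
  have hl := Real.log_le_log (by positivity) hfin
  rw [Real.log_mul (by positivity) (by positivity), Real.log_mul (by positivity) (by positivity),
    Real.log_exp, Real.log_exp, Real.log_div (by positivity) (by positivity), Real.log_pow] at hl
  rw [hZP]
  push_cast at hl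
  linarith

/-- Pressure inequality (Eq. (30) of the paper), Gaussian random fields:
`P_N(v_N,…,v_1) ≥ 2 P_{N-1}(2v_N+v_{N-1}, v_{N-2}, …, v_1) - log(1 + (cβ^d b_N)^{1/2})
 - E[max_k log(Z_{k,1}/Z_{k,2})] - 1/(cβ^{d-1})`, with `v_n = β b_n 2^{-2n}`. -/
theorem rfim_dyson_pressure_bound (α β fh c d : ℝ) (hα : 1 < α) (hβ : 0 < β)
    (hfh : 0 < fh) (hc : 0 < c) (hd : 0 ≤ d) (N : ℕ) (hN : 1 ≤ N) (r : ℕ) (hr : 1 ≤ r)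
    (hr1 : Real.sqrt (c * β^d * bcoef α N) < (r:ℝ))
    (hr2 : (r:ℝ) ≤ 1 + Real.sqrt (c * β^d * bcoef α N)) :
    (∫ η, pressure β fh N (vcoup α β) η ∂ gaussianFields (2^N)) ≥
      2 * (∫ η, pressure β fh (N-1)
            (Function.update (vcoup α β) (N-1) (2 * vcoup α β N + vcoup α β (N-1)))
            η ∂ gaussianFields (2^(N-1)))
      - Real.log (1 + Real.sqrt (c * β^d * bcoef α N))
      - (∫ η, maxgk α β fh N r hr η ∂ gaussianFields (2^N))
      - 1/(c * β^(d-1)) := by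
  obtain ⟨M, rfl⟩ : ∃ M, N = M + 1 := ⟨N - 1, by omega⟩
  simp only [Nat.add_sub_cancel]
  have hr0 : (0:ℝ) < r := by exact_mod_cast hr
  have hb : 0 < bcoef α (M+1) := by unfold bcoef; positivity
  have hβd : 0 < β^d := Real.rpow_pos_of_pos hβ d
  have hC : vcoup α β (M+1) * (2^(M+1) / r)^2 ≤ 1/(c * β^(d-1)) := by
    have h1 : vcoup α β (M+1) * (2^(M+1) / r)^2 = β * bcoef α (M+1) / (r:ℝ)^2 := by
      unfold vcoup
      rw [pow_mul' (2:ℝ) 2 (M+1)]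
      field_simp
    have h2 : 1/(c * β^(d-1)) = β * bcoef α (M+1) / (c * β^d * bcoef α (M+1)) := by
      rw [Real.rpow_sub hβ, Real.rpow_one]
      field_simp
    rw [h1, h2]
    refine div_le_div_of_nonneg_left (by positivity) (by positivity) ?_
    exact ((Real.sqrt_lt' hr0).1 hr1).le
  have hlog : Real.log r ≤ Real.log (1 + Real.sqrt (c * β^d * bcoef α (M+1))) :=
    Real.log_le_log hr0 hr2
  have : IsProbabilityMeasure (gaussianFields (2^(M+1))) := by
    unfold gaussianFields; infer_instance
  set v' := Function.update (vcoup α β) M (2 * vcoup α β (M+1) + vcoup α β M) with hv'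
  have hmp := mp_comp _ (loI_inj M)
  have hi1 := hmp.integrable_comp_of_integrable (pressure_integ β fh M v')
  have he : ∫ η, pressure β fh M v' (fun i => η (loI M i)) ∂ gaussianFields (2^(M+1))
      = ∫ η, pressure β fh M v' η ∂ gaussianFields (2^M) := by
    rw [← hmp.map_eq, integral_map hmp.measurable.aemeasurable]
    rw [hmp.map_eq]
    exact (pressure_integ β fh M v').aestronglyMeasurable
  have hi2 := maxgk_integ α β fh M r hr
  have hI1 : Integrable (fun η => 2 * pressure β fh M v' (fun i => η (loI M i)))
      (gaussianFields (2^(M+1))) := hi1.const_mul 2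
  have hI2 : Integrable (fun η => 2 * pressure β fh M v' (fun i => η (loI M i)) - Real.log r)
      (gaussianFields (2^(M+1))) := hI1.sub (integrable_const _)
  have hI3 : Integrable (fun η => 2 * pressure β fh M v' (fun i => η (loI M i)) - Real.log r
      - maxgk α β fh (M+1) r hr η) (gaussianFields (2^(M+1))) := hI2.sub hi2
  have hmain := integral_mono (hI3.sub (integrable_const (1/(c * β^(d-1)))))
    (pressure_integ β fh (M+1) (vcoup α β))
    (fun η => pointwise α β fh _ hβ M r hr hC η)
  simp only [Pi.sub_apply] at hmain
  rw [integral_sub hI3 (integrable_const _), integral_sub hI2 hi2,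
    integral_sub hI1 (integrable_const _), integral_const_mul, he] at hmain
  simp only [integral_const, probReal_univ, one_smul] at hmain
  change _ ≥ 2 * (∫ η, pressure β fh M v' η ∂ gaussianFields (2^M)) - _ - _ - _
  linarith

end
end

section
/- Let X_1, …, X_r be integrable real-valued random variables on a common probability space and let L > 0. If for every k and every t > 0 one has Pr( X_k − E[X_k] ≥ t ) ≤ exp(−t²/(2L²)), then E[ max_{1≤k≤r} X_k ] ≤ max_{1≤k≤r} E[X_k] + L · log( r · (1 + √(2πe)) ). -/
open MeasureTheory ProbabilityTheory

noncomputable section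

lemma aux_gauss : (∫⁻ t : ℝ, ENNReal.ofReal (Real.exp (t - t^2/2))) =
    ENNReal.ofReal (Real.sqrt (2 * Real.pi * Real.exp 1)) := by
  have e : (fun t : ℝ => Real.exp (t - t^2/2)) =
      fun t => Real.exp (1/2) * (fun s : ℝ => Real.exp (-(1/2) * s^2)) (t - 1) := by
    funext t
    simp only
    rw [← Real.exp_add]; congr 1; ring
  have hi : Integrable (fun t : ℝ => Real.exp (t - t^2/2)) := by
    rw [e]
    exact ((integrable_exp_neg_mul_sq (b := 1/2) (by norm_num)).comp_sub_right 1).const_mul _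
  rw [← ofReal_integral_eq_lintegral_ofReal hi (Filter.Eventually.of_forall fun t => (Real.exp_pos _).le)]
  congr 1
  rw [e, integral_const_mul, integral_sub_right_eq_self (fun s : ℝ => Real.exp (-(1/2) * s^2)) 1,
    integral_gaussian, Real.exp_half, mul_comm, ← Real.sqrt_mul (by positivity)]
  congr 1; ring

lemma aux_exp {Ω : Type*} [MeasurableSpace Ω] (μ : Measure Ω) [IsProbabilityMeasure μ]
    (Y : Ω → ℝ) (hY : AEMeasurable Y μ)
    (h : ∀ t : ℝ, 0 < t → (μ {ω | t ≤ Y ω}).toReal ≤ Real.exp (-t^2/2)) :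
    Integrable (fun ω => Real.exp (max (Y ω) 0) - 1) μ ∧
    ∫ ω, (Real.exp (max (Y ω) 0) - 1) ∂μ ≤ Real.sqrt (2 * Real.pi * Real.exp 1) := by
  have key := lintegral_comp_eq_lintegral_meas_le_mul μ (f := fun ω => max (Y ω) 0) (g := Real.exp)
    (Filter.Eventually.of_forall fun ω => le_max_right _ _) (hY.max aemeasurable_const)
    (fun t _ => Real.continuous_exp.intervalIntegrable _ _)
    (Filter.Eventually.of_forall fun t => (Real.exp_pos t).le)
  simp only [integral_exp, Real.exp_zero] at key
  have bd : (∫⁻ ω, ENNReal.ofReal (Real.exp (max (Y ω) 0) - 1) ∂μ) ≤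
      ENNReal.ofReal (Real.sqrt (2 * Real.pi * Real.exp 1)) := by
    rw [key, ← aux_gauss]
    refine le_trans (setLIntegral_mono' measurableSet_Ioi ?_) (setLIntegral_le_lintegral _ _)
    intro t ht
    have ht' : 0 < t := ht
    have hs : {ω | t ≤ max (Y ω) 0} = {ω | t ≤ Y ω} := by
      ext ω; simp [ht'.not_ge]
    rw [hs, ← ENNReal.ofReal_toReal (measure_ne_top μ {ω | t ≤ Y ω}),
      ← ENNReal.ofReal_mul ENNReal.toReal_nonneg]
    apply ENNReal.ofReal_le_ofReal
    calc _ ≤ Real.exp (-t^2/2) * Real.exp t := by gcongr; exact h t ht'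
      _ = _ := by rw [← Real.exp_add]; congr 1; ring
  have nn : ∀ ω, 0 ≤ Real.exp (max (Y ω) 0) - 1 := fun ω => by
    have := Real.one_le_exp (le_max_right (Y ω) 0); linarith
  have hm : AEStronglyMeasurable (fun ω => Real.exp (max (Y ω) 0) - 1) μ :=
    ((Real.measurable_exp.comp_aemeasurable (hY.max aemeasurable_const)).sub_const 1).aestronglyMeasurable
  refine ⟨⟨hm, ?_⟩, ?_⟩
  · rw [hasFiniteIntegral_iff_ofReal (Filter.Eventually.of_forall nn)]
    exact bd.trans_lt ENNReal.ofReal_lt_top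
  · rw [integral_eq_lintegral_of_nonneg_ae (Filter.Eventually.of_forall nn) hm]
    exact ENNReal.toReal_le_of_le_ofReal (Real.sqrt_nonneg _) bd

/-- If `X_1, …, X_r` each satisfy the one-sided sub-Gaussian tail bound
`Pr(X_k - E[X_k] ≥ t) ≤ exp(-t²/(2L²))` for all `t > 0`, then
`E[max_k X_k] ≤ max_k E[X_k] + L log(r (1 + √(2πe)))`. -/
theorem expected_max_of_subgaussian_tails {Ω : Type*} [MeasurableSpace Ω]
    (μ : Measure Ω) [IsProbabilityMeasure μ]
    (r : ℕ) (hr : 1 ≤ r) (X : Fin r → Ω → ℝ) (hX : ∀ k, Integrable (X k) μ)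
    (L : ℝ) (hL : 0 < L)
    (htail : ∀ k, ∀ t : ℝ, 0 < t →
      (μ {ω | (∫ ω', X k ω' ∂μ) + t ≤ X k ω}).toReal ≤ Real.exp (-t^2 / (2*L^2))) :
    (∫ ω, (Finset.univ.sup'
        (Finset.univ_nonempty_iff.mpr (Fin.pos_iff_nonempty.mp hr)) fun k => X k ω) ∂μ)
      ≤ (Finset.univ.sup'
          (Finset.univ_nonempty_iff.mpr (Fin.pos_iff_nonempty.mp hr)) fun k => ∫ ω, X k ω ∂μ)
        + L * Real.log (r * (1 + Real.sqrt (2 * Real.pi * Real.exp 1))) := by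
  have hne : (Finset.univ : Finset (Fin r)).Nonempty :=
    Finset.univ_nonempty_iff.mpr (Fin.pos_iff_nonempty.mp hr)
  set S := Real.sqrt (2 * Real.pi * Real.exp 1) with hS
  have hS0 : 0 ≤ S := Real.sqrt_nonneg _
  have hr0 : (0 : ℝ) < r := by exact_mod_cast hr
  have hpos : 0 < (r : ℝ) * (1 + S) := by positivity
  set c := Real.log (r * (1 + S)) with hc
  set M := Finset.univ.sup' hne fun k => ∫ ω, X k ω ∂μ with hM
  let Y : Fin r → Ω → ℝ := fun k ω => (X k ω - ∫ ω', X k ω' ∂μ) / L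
  have hY := fun k => aux_exp μ (Y k) (((hX k).aemeasurable.sub_const _).div_const L) (by
    intro t ht
    have := htail k (L * t) (by positivity)
    have e1 : {ω | t ≤ Y k ω} = {ω | (∫ ω', X k ω' ∂μ) + L * t ≤ X k ω} := by
      ext ω
      simp only [Set.mem_ofPred_eq, Y, le_div_iff₀ hL]
      constructor <;> intro h <;> linarith
    rw [e1]
    refine this.trans (le_of_eq ?_)
    congr 1; field_simp)
  let G : Fin r → Ω → ℝ := fun k ω => Real.exp (max (Y k ω) 0) - 1
  have hGnn : ∀ k ω, 0 ≤ G k ω := fun k ω => by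
    have := Real.one_le_exp (le_max_right (Y k ω) 0)
    simp only [G]; linarith
  have hexpc : Real.exp (-c) * (r * (1 + S)) = 1 := by
    rw [Real.exp_neg, hc, Real.exp_log hpos, inv_mul_cancel₀ hpos.ne']
  have hGI : ∀ k, Integrable (G k) μ := fun k => (hY k).1
  have hGb : ∀ k, ∫ ω, G k ω ∂μ ≤ S := fun k => (hY k).2
  have hG1 : ∀ k, Integrable (fun ω => 1 + G k ω) μ := fun k => (integrable_const (1:ℝ)).add (hGI k)
  have hsumI : Integrable (fun ω => ∑ k, (1 + G k ω)) μ :=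
    integrable_finsetSum _ fun k _ => hG1 k
  have hRI : Integrable (fun ω => (M + L * (c - 1)) + (L * Real.exp (-c)) * ∑ k, (1 + G k ω)) μ :=
    (integrable_const _).add (hsumI.const_mul _)
  have hsum : ∫ ω, ∑ k, (1 + G k ω) ∂μ ≤ r * (1 + S) := by
    rw [integral_finsetSum _ fun k _ => hG1 k]
    calc _ ≤ ∑ k : Fin r, (1 + S) := by
          apply Finset.sum_le_sum
          intro k _
          rw [integral_add (integrable_const _) (hGI k)]
          simpa using hGb k
      _ = _ := by simp; ring
  have hLI : Integrable (fun ω => Finset.univ.sup' hne fun k => X k ω) μ := by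
    have := Finset.sup'_induction (p := fun f : Ω → ℝ => Integrable f μ) hne X
      (fun a ha b hb => ha.sup hb) (fun k _ => hX k)
    convert this using 1
    funext ω
    simp [Finset.sup'_apply]
  have hle : ∀ ω, (Finset.univ.sup' hne fun k => X k ω) ≤
      (M + L * (c - 1)) + (L * Real.exp (-c)) * ∑ k, (1 + G k ω) := by
    intro ω
    apply Finset.sup'_le
    intro k _
    have h1 : (∫ ω', X k ω' ∂μ) ≤ M :=
      Finset.le_sup' (fun k => ∫ ω, X k ω ∂μ) (Finset.mem_univ k)
    have h2 : X k ω = (∫ ω', X k ω' ∂μ) + L * Y k ω := by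
      simp only [Y]; field_simp; ring
    have h3 : Y k ω ≤ c - 1 + Real.exp (-c) * (1 + G k ω) := by
      have a := Real.add_one_le_exp (Y k ω - c)
      have b : Real.exp (Y k ω - c) ≤ Real.exp (-c) * (1 + G k ω) := by
        have : 1 + G k ω = Real.exp (max (Y k ω) 0) := by simp [G]
        rw [this, ← Real.exp_add]
        apply Real.exp_le_exp.mpr
        have := le_max_left (Y k ω) 0
        linarith
      linarith
    have h4 : 1 + G k ω ≤ ∑ k, (1 + G k ω) :=
      Finset.single_le_sum (f := fun k => 1 + G k ω)
        (fun j _ => by have := hGnn j ω; positivity) (Finset.mem_univ k)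
    have h5 : Y k ω ≤ c - 1 + Real.exp (-c) * ∑ k, (1 + G k ω) :=
      h3.trans (by gcongr)
    have h6 := mul_le_mul_of_nonneg_left h5 hL.le
    rw [h2]
    linarith
  refine (integral_mono hLI hRI hle).trans ?_
  rw [integral_add (integrable_const _) (hsumI.const_mul _), integral_const_mul]
  simp only [integral_const, probReal_univ, one_smul]
  have h7 : L * Real.exp (-c) * ∫ ω, ∑ k, (1 + G k ω) ∂μ ≤ L * Real.exp (-c) * (r * (1 + S)) := by
    gcongr
  rw [mul_assoc L _ (r * (1 + S)), hexpc] at h7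
  linarith

end
end

section
/- Fix α > 1, β > 0, and N ≥ 1, and consider the Dyson hierarchical Ising model without random field (h = 0). Then the normalized squared total magnetization f_N = 2^{−2N} ⟨S_{N,1}²⟩_N satisfies Dyson's recurrence inequality f_N ≥ f_{N−1} − (1/(β b_N)) · ( 1 + log(1 + (β b_N)^{1/2}) ). -/
open MeasureTheory ProbabilityTheory Filter
open scoped Classical

noncomputable section

theorem aux_bin (r : ℕ) (hr : 1 ≤ r) (x : ℝ) (hx : |x| ≤ 1) :
    ∃ k : Fin r, (k:ℝ) * (2 / r) - 1 ≤ x ∧ x ≤ ((k:ℝ) + 1) * (2 / r) - 1 := by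
  have hr0 : (0:ℝ) < r := by exact_mod_cast hr
  obtain ⟨h1, h2⟩ := abs_le.mp hx
  have key : ∀ c : ℝ, c * (2 / (r:ℝ)) = (c * 2) / r := fun c => by ring
  by_cases hx1 : x = 1
  · refine ⟨⟨r - 1, by omega⟩, ?_, ?_⟩
    · simp only [Nat.cast_sub hr, Nat.cast_one]
      rw [key, sub_le_iff_le_add, div_le_iff₀ hr0]
      subst hx1; linarith
    · simp only [Nat.cast_sub hr, Nat.cast_one]
      rw [key, le_sub_iff_add_le, le_div_iff₀ hr0]
      subst hx1; linarith
  · have hlt : x < 1 := lt_of_le_of_ne h2 hx1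
    have h0 : 0 ≤ (x + 1) * r / 2 := by
      have : 0 ≤ x + 1 := by linarith
      positivity
    refine ⟨⟨⌊(x + 1) * r / 2⌋₊, ?_⟩, ?_, ?_⟩
    · rw [Nat.floor_lt h0]; nlinarith
    · have := Nat.floor_le h0
      simp only
      rw [key, sub_le_iff_le_add, div_le_iff₀ hr0]
      linarith
    · have := (Nat.lt_floor_add_one ((x + 1) * r / 2)).le
      simp only
      rw [key, le_sub_iff_add_le, le_div_iff₀ hr0]
      linarith

theorem aux_jensen {Ω : Type*} [Fintype Ω] (p h : Ω → ℝ) (hp : ∀ a, 0 ≤ p a)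
    (h1 : ∑ a, p a = 1) : Real.exp (∑ a, p a * h a) ≤ ∑ a, p a * Real.exp (h a) := by
  set m := ∑ a, p a * h a with hm
  have h2 : ∀ a, p a * (Real.exp m * (1 + h a - m)) ≤ p a * Real.exp (h a) := by
    intro a
    refine mul_le_mul_of_nonneg_left ?_ (hp a)
    have : Real.exp (h a) = Real.exp m * Real.exp (h a - m) := by
      rw [← Real.exp_add]; congr 1; ring
    rw [this]
    refine mul_le_mul_of_nonneg_left ?_ (Real.exp_pos m).le
    linarith [Real.add_one_le_exp (h a - m)]
  have h3 := Finset.sum_le_sum (fun a (_ : a ∈ Finset.univ) => h2 a)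
  have h4 : ∑ a, p a * (Real.exp m * (1 + h a - m)) = Real.exp m := by
    have : ∀ a, p a * (Real.exp m * (1 + h a - m))
        = Real.exp m * ((1 - m) * p a + p a * h a) := fun a => by ring
    simp_rw [this]
    rw [← Finset.mul_sum, Finset.sum_add_distrib, ← Finset.mul_sum, h1, ← hm]
    ring
  rwa [h4] at h3

theorem aux_entropy {Ω : Type*} [Fintype Ω] (p g : Ω → ℝ) (hp : ∀ a, 0 ≤ p a)
    (hZ : 0 < ∑ a, p a * Real.exp (g a)) (h1 : ∑ a, p a = 1) :
    (∑ a, p a * Real.exp (g a)) * Real.log (∑ a, p a * Real.exp (g a)) ≤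
      ∑ a, g a * (p a * Real.exp (g a)) := by
  set Z := ∑ a, p a * Real.exp (g a) with hZd
  have h2 : ∀ a, p a * Real.exp (g a) - p a * Z
      ≤ g a * (p a * Real.exp (g a)) - Real.log Z * (p a * Real.exp (g a)) := by
    intro a
    have e : Z = Real.exp (g a) * Real.exp (Real.log Z - g a) := by
      rw [← Real.exp_add]
      rw [show g a + (Real.log Z - g a) = Real.log Z by ring, Real.exp_log hZ]
    have h3 : Real.exp (g a) * (Real.log Z - g a + 1) ≤ Z := by
      conv_rhs => rw [e]
      exact mul_le_mul_of_nonneg_left (Real.add_one_le_exp _) (Real.exp_pos _).le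
    have := mul_le_mul_of_nonneg_left h3 (hp a)
    nlinarith
  have h3 := Finset.sum_le_sum (fun a (_ : a ∈ Finset.univ) => h2 a)
  rw [Finset.sum_sub_distrib, Finset.sum_sub_distrib, ← Finset.sum_mul, ← Finset.mul_sum,
    ← hZd, h1] at h3
  linarith

theorem aux_lower {Ω : Type*} [Fintype Ω] (p X : Ω → ℝ) (hp : ∀ a, 0 ≤ p a)
    (h1 : ∑ a, p a = 1) (hX : ∀ a, |X a| ≤ 1) (B : ℝ) (hB : 0 < B) :
    B * ∑ a, p a * X a ^ 2 - (1 + Real.log (1 + Real.sqrt B)) ≤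
      Real.log (∑ a, ∑ b, p a * p b * Real.exp (B * ((X a + X b) ^ 2 / 4))) := by
  have hs : 0 < Real.sqrt B := Real.sqrt_pos.mpr hB
  set r := ⌈Real.sqrt B⌉₊ with hr
  have hr1 : 1 ≤ r := Nat.one_le_ceil_iff.mpr hs
  have hr0 : (0:ℝ) < r := by exact_mod_cast hr1
  have hrle : (r:ℝ) ≤ 1 + Real.sqrt B := by
    have := (Nat.ceil_lt_add_one hs.le).le
    linarith
  have hBr : B ≤ (r:ℝ) ^ 2 := by
    have h := Nat.le_ceil (Real.sqrt B)
    calc B = Real.sqrt B ^ 2 := (Real.sq_sqrt hB.le).symm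
      _ ≤ _ := pow_le_pow_left₀ hs.le h 2
  choose k hk1 hk2 using fun a => aux_bin r hr1 (X a) (hX a)
  set G : Ω → ℝ := fun a => p a * Real.exp (B / 2 * X a ^ 2) with hG
  have hGnn : ∀ a, 0 ≤ G a := fun a => mul_nonneg (hp a) (Real.exp_pos _).le
  have hpt : ∀ a b, (if k a = k b then Real.exp (-1) * (G a * G b) else 0) ≤
      p a * p b * Real.exp (B * ((X a + X b) ^ 2 / 4)) := by
    intro a b
    split_ifs with hab
    · have hd : (X a - X b) ^ 2 ≤ (2 / (r:ℝ)) ^ 2 := by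
        apply sq_le_sq'
        · have := hk1 a; have := hk2 b; rw [← hab] at this; linarith
        · have := hk2 a; have := hk1 b; rw [← hab] at this; linarith
      have hd2 : B * (X a - X b) ^ 2 ≤ 4 := by
        calc B * (X a - X b) ^ 2 ≤ (r:ℝ) ^ 2 * (2 / (r:ℝ)) ^ 2 :=
              mul_le_mul hBr hd (sq_nonneg _) (sq_nonneg _)
          _ = 4 := by field_simp; norm_num
      have : Real.exp (-1) * (G a * G b) = p a * p b *
          Real.exp (-1 + (B / 2 * X a ^ 2 + B / 2 * X b ^ 2)) := by
        rw [Real.exp_add, Real.exp_add]; simp only [hG]; ring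
      rw [this]
      refine mul_le_mul_of_nonneg_left (Real.exp_le_exp.mpr ?_) (mul_nonneg (hp a) (hp b))
      nlinarith
    · exact mul_nonneg (mul_nonneg (hp a) (hp b)) (Real.exp_pos _).le
  have hsum := Finset.sum_le_sum (fun a (_ : a ∈ Finset.univ) =>
    Finset.sum_le_sum (fun b (_ : b ∈ Finset.univ) => hpt a b))
  have hsq : ∑ a, ∑ b, (if k a = k b then Real.exp (-1) * (G a * G b) else 0)
      = Real.exp (-1) * ∑ j : Fin r, (∑ a, if k a = j then G a else 0) ^ 2 := by
    have e1 : ∀ j : Fin r, (∑ a, if k a = j then G a else 0) ^ 2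
        = ∑ a, ∑ b, (if k a = j then (if k b = j then G a * G b else 0) else 0) := by
      intro j
      rw [sq, Finset.sum_mul_sum]
      refine Finset.sum_congr rfl fun a _ => Finset.sum_congr rfl fun b _ => ?_
      split_ifs <;> simp
    simp_rw [e1]
    conv_rhs => rw [Finset.sum_comm, Finset.mul_sum]
    refine Finset.sum_congr rfl fun a _ => ?_
    conv_rhs => rw [Finset.sum_comm, Finset.mul_sum]
    refine Finset.sum_congr rfl fun b _ => ?_
    rw [Finset.sum_ite_eq]
    by_cases hab : k a = k b
    · simp [hab]
    · simp [hab, Ne.symm hab]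
  have htot : (∑ j : Fin r, ∑ a, (if k a = j then G a else 0)) = ∑ a, G a := by
    rw [Finset.sum_comm]
    refine Finset.sum_congr rfl fun a _ => ?_
    rw [Finset.sum_ite_eq]; simp
  have hcs := sq_sum_le_card_mul_sum_sq (s := (Finset.univ : Finset (Fin r)))
    (f := fun j => (∑ a, if k a = j then G a else 0 : ℝ))
  rw [htot, Finset.card_univ, Fintype.card_fin] at hcs
  have hj := aux_jensen p (fun a => B / 2 * X a ^ 2) hp h1
  have hj2 : (Real.exp (∑ a, p a * (B / 2 * X a ^ 2))) ^ 2 ≤ (∑ a, G a) ^ 2 :=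
    pow_le_pow_left₀ (Real.exp_pos _).le hj 2
  have hE : (Real.exp (∑ a, p a * (B / 2 * X a ^ 2))) ^ 2 =
      Real.exp (B * ∑ a, p a * X a ^ 2) := by
    rw [← Real.exp_nat_mul]
    congr 1
    rw [Finset.mul_sum, Finset.mul_sum]
    refine Finset.sum_congr rfl fun a _ => ?_
    push_cast; ring
  rw [hE] at hj2
  rw [hsq] at hsum
  set Z := ∑ a, ∑ b, p a * p b * Real.exp (B * ((X a + X b) ^ 2 / 4)) with hZ
  set Q := ∑ j : Fin r, (∑ a, if k a = j then G a else 0) ^ 2 with hQ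
  have hQ0 : 0 ≤ Q := Finset.sum_nonneg fun _ _ => sq_nonneg _
  have hQ1 : Real.exp (B * ∑ a, p a * X a ^ 2) ≤ (1 + Real.sqrt B) * Q :=
    (hj2.trans hcs).trans (mul_le_mul_of_nonneg_right hrle hQ0)
  have hpos : 0 < 1 + Real.sqrt B := by linarith
  have hfin : Real.exp (B * ∑ a, p a * X a ^ 2 - (1 + Real.log (1 + Real.sqrt B))) ≤ Z := by
    refine le_trans ?_ hsum
    rw [show B * ∑ a, p a * X a ^ 2 - (1 + Real.log (1 + Real.sqrt B)) =
      -1 + (B * ∑ a, p a * X a ^ 2 - Real.log (1 + Real.sqrt B)) by ring, Real.exp_add]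
    refine mul_le_mul_of_nonneg_left ?_ (Real.exp_pos _).le
    rw [Real.exp_sub, Real.exp_log hpos, div_le_iff₀ hpos]
    linarith
  exact (Real.le_log_iff_exp_le (lt_of_lt_of_le (Real.exp_pos _) hfin)).mpr hfin

theorem aux_main {Ω : Type*} [Fintype Ω] [Nonempty Ω] (w X : Ω → ℝ) (hw : ∀ a, 0 < w a)
    (hX : ∀ a, |X a| ≤ 1) (B : ℝ) (hB : 0 < B) :
    (∑ a, X a ^ 2 * w a) / (∑ a, w a) - (1 / B) * (1 + Real.log (1 + Real.sqrt B)) ≤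
      (∑ q : Ω × Ω, (X q.1 + X q.2) ^ 2 / 4 *
          (w q.1 * w q.2 * Real.exp (B * ((X q.1 + X q.2) ^ 2 / 4)))) /
        ∑ q : Ω × Ω, w q.1 * w q.2 * Real.exp (B * ((X q.1 + X q.2) ^ 2 / 4)) := by
  set W := ∑ a, w a with hW
  have hW0 : 0 < W := Finset.sum_pos (fun a _ => hw a) Finset.univ_nonempty
  set p : Ω → ℝ := fun a => w a / W with hpd
  have hp : ∀ a, 0 < p a := fun a => div_pos (hw a) hW0
  have hp1 : ∑ a, p a = 1 := by
    simp only [hpd]; rw [← Finset.sum_div]; exact div_self hW0.ne'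
  have hwp : ∀ a, w a = W * p a := fun a => by simp only [hpd]; field_simp
  have e0 : (∑ a, X a ^ 2 * w a) / W = ∑ a, p a * X a ^ 2 := by
    rw [Finset.sum_div]
    exact Finset.sum_congr rfl fun a _ => by simp only [hpd]; ring
  set P : Ω × Ω → ℝ := fun q => p q.1 * p q.2 with hP
  set u : Ω × Ω → ℝ := fun q => (X q.1 + X q.2) ^ 2 / 4 with hu
  have hP0 : ∀ q, 0 < P q := fun q => mul_pos (hp _) (hp _)
  have hP1 : ∑ q, P q = 1 := by
    rw [Fintype.sum_prod_type]
    simp only [hP]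
    rw [← Finset.sum_mul_sum, hp1, one_mul]
  set Z := ∑ q, P q * Real.exp (B * u q) with hZ
  have hZ0 : 0 < Z := Finset.sum_pos (fun q _ => mul_pos (hP0 q) (Real.exp_pos _))
    Finset.univ_nonempty
  have e1 : ∑ q : Ω × Ω, w q.1 * w q.2 * Real.exp (B * ((X q.1 + X q.2) ^ 2 / 4))
      = W ^ 2 * Z := by
    rw [hZ, Finset.mul_sum]
    refine Finset.sum_congr rfl fun q _ => ?_
    rw [hwp q.1, hwp q.2]; simp only [hP, hu]; ring
  have e2 : ∑ q : Ω × Ω, (X q.1 + X q.2) ^ 2 / 4 *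
      (w q.1 * w q.2 * Real.exp (B * ((X q.1 + X q.2) ^ 2 / 4)))
      = W ^ 2 * ∑ q, u q * (P q * Real.exp (B * u q)) := by
    rw [Finset.mul_sum]
    refine Finset.sum_congr rfl fun q _ => ?_
    rw [hwp q.1, hwp q.2]; simp only [hP, hu]; ring
  rw [e0, e1, e2, mul_div_mul_left _ _ (pow_pos hW0 2).ne']
  have hent := aux_entropy P (fun q => B * u q) (fun q => (hP0 q).le) hZ0 hP1
  have hlow := aux_lower p X (fun a => (hp a).le) hp1 hX B hB
  have e3 : ∑ a, ∑ b, p a * p b * Real.exp (B * ((X a + X b) ^ 2 / 4)) = Z := by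
    rw [hZ, Fintype.sum_prod_type]
  rw [e3] at hlow
  have e4 : ∑ q, B * u q * (P q * Real.exp (B * u q)) =
      B * ∑ q, u q * (P q * Real.exp (B * u q)) := by
    rw [Finset.mul_sum]
    exact Finset.sum_congr rfl fun q _ => by ring
  simp only [e4] at hent
  rw [le_div_iff₀ hZ0]
  have h5 := mul_le_mul_of_nonneg_left hlow hZ0.le
  have h6 := h5.trans hent
  have h7 : B * ((∑ a, p a * X a ^ 2 - 1 / B * (1 + Real.log (1 + Real.sqrt B))) * Z) =
      Z * (B * ∑ a, p a * X a ^ 2 - (1 + Real.log (1 + Real.sqrt B))) := by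
    field_simp
  exact le_of_mul_le_mul_left (h7.trans_le h6) hB

def auxIdx (M : ℕ) : Fin (2^M) ⊕ Fin (2^M) ≃ Fin (2^(M+1)) :=
  finSumFinEquiv.trans (finCongr (by rw [pow_succ]; omega))

def auxSplit (M : ℕ) : (Fin (2^(M+1)) → Bool) ≃ (Fin (2^M) → Bool) × (Fin (2^M) → Bool) :=
  ((auxIdx M).symm.arrowCongr (Equiv.refl Bool)).trans (Equiv.sumArrowEquivProdArrow _ _ _)

theorem auxSplit_fst (M : ℕ) (σ : Fin (2^(M+1)) → Bool) (i : Fin (2^M)) (h) :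
    (auxSplit M σ).1 i = σ ⟨i.1, h⟩ := rfl

theorem auxSplit_snd (M : ℕ) (σ : Fin (2^(M+1)) → Bool) (i : Fin (2^M)) (h) :
    (auxSplit M σ).2 i = σ ⟨2^M + i.1, h⟩ := rfl

theorem aux_total (M : ℕ) (σ : Fin (2^(M+1)) → Bool) :
    totalSpin (M+1) σ = totalSpin M (auxSplit M σ).1 + totalSpin M (auxSplit M σ).2 := by
  unfold totalSpin
  rw [← (auxIdx M).sum_comp, Fintype.sum_sum_type]
  rfl

theorem aux_H (α : ℝ) (M : ℕ) (σ : Fin (2^(M+1)) → Bool) :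
    dysonH α (M+1) σ = dysonH α M (auxSplit M σ).1 + dysonH α M (auxSplit M σ).2
      - (2:ℝ) ^ (-(α * ((M:ℝ)+1))) *
        (totalSpin M (auxSplit M σ).1 + totalSpin M (auxSplit M σ).2) ^ 2 := by
  rw [← aux_total]
  unfold totalSpin
  rw [sq, Finset.sum_mul_sum]
  rfl

theorem aux_abs (M : ℕ) (σ : Fin (2^M) → Bool) : |totalSpin M σ / 2^M| ≤ 1 := by
  rw [abs_div, abs_of_pos (show (0:ℝ) < 2^M by positivity), div_le_one (by positivity)]
  unfold totalSpin
  refine (Finset.abs_sum_le_sum_abs _ _).trans ?_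
  have : ∀ i, |spin (σ i)| = 1 := by
    intro i; unfold spin; split_ifs <;> simp
  simp [this]

/-- Dyson's recurrence inequality (Eq. (4.25) in Dyson's paper) for the model without
random field: `f_N ≥ f_{N-1} - (1/(β b_N)) (1 + log(1 + (β b_N)^{1/2}))`. -/
theorem dyson_recurrence_no_field (α β : ℝ) (hα : 1 < α) (hβ : 0 < β)
    (N : ℕ) (hN : 1 ≤ N) :
    fNoField α β N ≥ fNoField α β (N-1)
      - (1/(β * bcoef α N)) * (1 + Real.log (1 + Real.sqrt (β * bcoef α N))) := by
  obtain ⟨M, rfl⟩ : ∃ M, N = M + 1 := ⟨N - 1, by omega⟩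
  rw [Nat.add_sub_cancel]
  have hb : 0 < bcoef α (M+1) := by unfold bcoef; positivity
  set B := β * bcoef α (M+1) with hBd
  have hB : 0 < B := mul_pos hβ hb
  have hcoef : β * (2:ℝ) ^ (-(α * ((M:ℝ)+1))) = B / (4 * (2^M)^2) := by
    rw [hBd, mul_div_assoc]
    congr 1
    unfold bcoef
    rw [eq_div_iff (by positivity)]
    have : (4 * (2^M)^2 : ℝ) = (2:ℝ) ^ (2 * ((M:ℝ)+1)) := by
      rw [Real.rpow_mul (by norm_num), Real.rpow_add_one (by norm_num), Real.rpow_natCast]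
      norm_num
      rw [← pow_mul, mul_comm M 2, pow_mul]
      norm_num
      ring
    rw [this, ← Real.rpow_add (by norm_num)]
    congr 1
    push_cast
    ring
  have hmain := aux_main (fun σ : Fin (2^M) → Bool => Real.exp (-β * dysonH α M σ))
    (fun σ => totalSpin M σ / 2^M) (fun _ => Real.exp_pos _) (aux_abs M) B hB
  have hwt : ∀ σ : Fin (2^(M+1)) → Bool, Real.exp (-β * dysonH α (M+1) σ) =
      Real.exp (-β * dysonH α M (auxSplit M σ).1) * Real.exp (-β * dysonH α M (auxSplit M σ).2) *
      Real.exp (B * ((totalSpin M (auxSplit M σ).1 / 2^M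
        + totalSpin M (auxSplit M σ).2 / 2^M)^2 / 4)) := by
    intro σ
    rw [← Real.exp_add, ← Real.exp_add, aux_H]
    congr 1
    have : B * ((totalSpin M (auxSplit M σ).1 / 2^M
        + totalSpin M (auxSplit M σ).2 / 2^M)^2 / 4) = B / (4 * (2^M)^2) *
        (totalSpin M (auxSplit M σ).1 + totalSpin M (auxSplit M σ).2) ^ 2 := by
      field_simp
    rw [this, ← hcoef]
    ring
  have hM : fNoField α β M = (∑ σ : Fin (2^M) → Bool, (totalSpin M σ / 2^M) ^ 2 *
      Real.exp (-β * dysonH α M σ)) / ∑ σ : Fin (2^M) → Bool, Real.exp (-β * dysonH α M σ) := by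
    unfold fNoField gibbs dysonHRF
    simp only [zero_mul, sub_zero]
    rw [← mul_div_assoc, Finset.mul_sum]
    congr 1
    refine Finset.sum_congr rfl fun σ _ => ?_
    rw [mul_comm 2 M, pow_mul]
    field_simp
  have hM1 : fNoField α β (M+1) = (∑ q : (Fin (2^M) → Bool) × (Fin (2^M) → Bool),
        (totalSpin M q.1 / 2^M + totalSpin M q.2 / 2^M) ^ 2 / 4 *
          (Real.exp (-β * dysonH α M q.1) * Real.exp (-β * dysonH α M q.2) *
          Real.exp (B * ((totalSpin M q.1 / 2^M + totalSpin M q.2 / 2^M) ^ 2 / 4)))) /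
        ∑ q : (Fin (2^M) → Bool) × (Fin (2^M) → Bool),
          Real.exp (-β * dysonH α M q.1) * Real.exp (-β * dysonH α M q.2) *
          Real.exp (B * ((totalSpin M q.1 / 2^M + totalSpin M q.2 / 2^M) ^ 2 / 4)) := by
    unfold fNoField gibbs dysonHRF
    simp only [zero_mul, sub_zero]
    rw [← mul_div_assoc, Finset.mul_sum, ← (auxSplit M).sum_comp, ← (auxSplit M).sum_comp]
    congr 1
    · refine Finset.sum_congr rfl fun σ _ => ?_
      rw [← hwt, aux_total, mul_comm 2 (M+1), pow_mul]
      field_simp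
      ring
    · exact Finset.sum_congr rfl fun σ _ => hwt σ
  rw [hM, hM1]
  exact hmain

end
end
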